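/- arXiv:math/0303299 — 3 statements merged into one kernel-verified Lean document; each statement's English description precedes it below -/
import Mathlib

section
/- Let P_1,…,P_t (t ≥ 1) be distinct points of k^s and let I = m_{P_1} ∩ ⋯ ∩ m_{P_t} be the ideal of polynomials vanishing at all of them. Then I^⊥ = (m_{P_1})^⊥ ⊕ ⋯ ⊕ (m_{P_t})^⊥: the submodules (m_{P_i})^⊥ of Hom_k(S,k) are independent and their sum equals I^⊥. -/
open MvPolynomial

variable {k : Type*} [Field k] {s : ℕ}

/-- The contraction action of `S = k[X_1,…,X_s]` on its linear dual `Hom_k(S,k)`: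
`(f • Λ)(g) = Λ(f g)`. -/
noncomputable instance dualSMul :
    SMul (MvPolynomial (Fin s) k) (Module.Dual k (MvPolynomial (Fin s) k)) :=
  ⟨fun f Λ => Λ.comp (LinearMap.mulLeft k f)⟩

theorem dual_smul_apply (f : MvPolynomial (Fin s) k)
    (Λ : Module.Dual k (MvPolynomial (Fin s) k)) (p : MvPolynomial (Fin s) k) :
    (f • Λ) p = Λ (f * p) := rfl

noncomputable instance dualMulAction :
    MulAction (MvPolynomial (Fin s) k) (Module.Dual k (MvPolynomial (Fin s) k)) where
  one_smul Λ := by refine LinearMap.ext fun p => ?_; simp [dual_smul_apply]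
  mul_smul f g Λ := by refine LinearMap.ext fun p => ?_; simp only [dual_smul_apply]; congr 1; ring

noncomputable instance dualDistribMulAction :
    DistribMulAction (MvPolynomial (Fin s) k) (Module.Dual k (MvPolynomial (Fin s) k)) where
  smul_zero f := by refine LinearMap.ext fun p => ?_; simp [dual_smul_apply]
  smul_add f Λ₁ Λ₂ := by refine LinearMap.ext fun p => ?_; simp [dual_smul_apply]

noncomputable instance dualModule :
    Module (MvPolynomial (Fin s) k) (Module.Dual k (MvPolynomial (Fin s) k)) where
  add_smul f g Λ := by refine LinearMap.ext fun p => ?_; simp [dual_smul_apply, add_mul]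
  zero_smul Λ := by refine LinearMap.ext fun p => ?_; simp [dual_smul_apply]

/-- The inverse system (annihilator) `I^⊥ ⊆ Hom_k(S,k)` of an ideal `I ⊆ S`,
as an `S`-submodule of the dual. -/
noncomputable def idealPerp (I : Ideal (MvPolynomial (Fin s) k)) :
    Submodule (MvPolynomial (Fin s) k) (Module.Dual k (MvPolynomial (Fin s) k)) where
  carrier := {Λ | ∀ p ∈ I, Λ p = 0}
  zero_mem' := by intro p _; simp
  add_mem' := by intro Λ₁ Λ₂ h₁ h₂ p hp; simp [h₁ p hp, h₂ p hp]
  smul_mem' := by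
    intro f Λ hΛ p hp
    simpa [dual_smul_apply] using hΛ (f * p) (I.mul_mem_left f hp)

/-- The annihilator `H^⊥ ⊆ S` of an `S`-submodule `H ⊆ Hom_k(S,k)`, as an ideal of `S`. -/
noncomputable def submodPerp
    (H : Submodule (MvPolynomial (Fin s) k) (Module.Dual k (MvPolynomial (Fin s) k))) :
    Ideal (MvPolynomial (Fin s) k) where
  carrier := {p | ∀ Λ ∈ H, Λ p = 0}
  zero_mem' := by intro Λ _; simp
  add_mem' := by intro a b ha hb Λ hΛ; simp [ha Λ hΛ, hb Λ hΛ]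
  smul_mem' := by
    intro c p hp Λ hΛ
    simpa [smul_eq_mul, dual_smul_apply] using hp (c • Λ) (H.smul_mem c hΛ)

/-- The maximal ideal `m_P = {f ∈ S : f(P) = 0}` of `S = k[X_1,…,X_s]` at a point `P ∈ k^s`. -/
noncomputable def maxIdealAt (P : Fin s → k) : Ideal (MvPolynomial (Fin s) k) :=
  RingHom.ker (MvPolynomial.eval P)

theorem idealPerp_anti {I J : Ideal (MvPolynomial (Fin s) k)} (h : I ≤ J) :
    idealPerp J ≤ idealPerp I := fun _ hΛ p hp => hΛ p (h hp)

theorem mem_maxIdealAt {Q : Fin s → k} {p : MvPolynomial (Fin s) k} :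
    p ∈ maxIdealAt Q ↔ eval Q p = 0 := RingHom.mem_ker

/-- Distinct points are separated by a polynomial of value `1` at one and `0` at the other. -/
theorem exists_eval_eq_one_eval_eq_zero {Q R : Fin s → k} (h : Q ≠ R) :
    ∃ f : MvPolynomial (Fin s) k, eval Q f = 1 ∧ eval R f = 0 := by
  obtain ⟨c, hc⟩ := Function.ne_iff.mp h
  refine ⟨C (Q c - R c)⁻¹ * (X c - C (R c)), ?_, by simp⟩
  simp [inv_mul_cancel₀ (sub_ne_zero.mpr hc)]

/-- Finitely many distinct points admit a family of polynomials dual to evaluation. -/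
theorem exists_eval_eq_ite {ι : Type*} [Fintype ι] [DecidableEq ι] {P : ι → Fin s → k}
    (hP : Function.Injective P) :
    ∃ e : ι → MvPolynomial (Fin s) k, ∀ i j, eval (P j) (e i) = if j = i then 1 else 0 := by
  have h (i j : ι) : ∃ f : MvPolynomial (Fin s) k,
      j ≠ i → eval (P i) f = 1 ∧ eval (P j) f = 0 := by
    by_cases hij : j = i
    · exact ⟨0, fun h => absurd hij h⟩
    · obtain ⟨f, hf⟩ := exists_eval_eq_one_eval_eq_zero (hP.ne (Ne.symm hij))
      exact ⟨f, fun _ => hf⟩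
  choose f hf using h
  refine ⟨fun i => ∏ j ∈ Finset.univ.erase i, f i j, fun i j => ?_⟩
  rw [map_prod]
  split_ifs with hij
  · subst hij
    exact Finset.prod_eq_one fun l hl => (hf j l (Finset.ne_of_mem_erase hl)).1
  · exact Finset.prod_eq_zero (Finset.mem_erase.mpr ⟨hij, Finset.mem_univ j⟩) (hf i j hij).2

/-- For `t ≥ 1` distinct points `P_1,…,P_t` of `k^s` and
`I = m_{P_1} ∩ ⋯ ∩ m_{P_t}`, one has `I^⊥ = (m_{P_1})^⊥ ⊕ ⋯ ⊕ (m_{P_t})^⊥`: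
the submodules `(m_{P_i})^⊥` are independent and their sum is `I^⊥`. -/
theorem perp_of_ideal_of_points (k : Type*) [Field k] (s : ℕ) (hs : 1 ≤ s)
    (t : ℕ) (ht : 1 ≤ t) (P : Fin t → (Fin s → k)) (hP : Function.Injective P) :
    idealPerp (⨅ i, maxIdealAt (P i)) = (⨆ i, idealPerp (maxIdealAt (P i))) ∧
    iSupIndep (fun i => idealPerp (maxIdealAt (P i))) := by
  obtain ⟨e, he⟩ := exists_eval_eq_ite hP
  refine ⟨le_antisymm (fun Λ hΛ => ?_) (iSup_le fun i => idealPerp_anti (iInf_le _ i)), ?_⟩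
  · have hsum : Λ = ∑ i, e i • Λ := by
      refine LinearMap.ext fun p => ?_
      have h0 : Λ (p - ∑ i, e i * p) = 0 := by
        refine hΛ _ ((Submodule.mem_iInf _).mpr fun j => mem_maxIdealAt.mpr ?_)
        simp [he]
      simpa [dual_smul_apply, LinearMap.sum_apply, sub_eq_zero] using h0
    rw [hsum]
    refine Submodule.sum_mem _ fun i _ => Submodule.mem_iSup_of_mem i fun p hp => ?_
    rw [dual_smul_apply]
    refine hΛ _ ((Submodule.mem_iInf _).mpr fun j => mem_maxIdealAt.mpr ?_)
    rw [map_mul, he]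
    split_ifs with hij
    · rw [hij, mem_maxIdealAt.mp hp, mul_zero]
    · rw [zero_mul]
  · refine fun i => Submodule.disjoint_def.mpr fun Λ hi hne => LinearMap.ext fun p => ?_
    have hle : ⨆ j, ⨆ _ : j ≠ i, idealPerp (maxIdealAt (P j)) ≤
        idealPerp (⨅ j, ⨅ _ : j ≠ i, maxIdealAt (P j)) :=
      iSup₂_le fun j hj => idealPerp_anti (iInf₂_le j hj)
    have h1 : Λ (e i * p) = 0 := by
      refine hle hne _ ?_
      simp only [Submodule.mem_iInf]
      intro j hj
      rw [mem_maxIdealAt, map_mul, he, if_neg hj, zero_mul]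
    have h2 : Λ (p - e i * p) = 0 :=
      hi _ (mem_maxIdealAt.mpr (by simp [he]))
    rwa [map_sub, h1, sub_zero] at h2
end

section
/- Let E ⊆ k^s be a finite set of points and fix one error vector e : E → k with e_P ≠ 0 for all P ∈ E. Then the error-locator ideal satisfies I(E) = ⟨Λ_e⟩^⊥, i.e., I(E) = {f ∈ S : Λ_e(f p) = 0 for all p ∈ S}, where ⟨Λ_e⟩ is the S-submodule of Hom_k(S,k) generated by Λ_e. -/
open MvPolynomial

variable {k : Type*} [Field k] {s : ℕ}

/-- The error-locator ideal `I(E) = {f ∈ S : f(P) = 0 for all P ∈ E}` of a finite set of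
points `E ⊆ k^s`. -/
noncomputable def locatorIdeal (E : Finset (Fin s → k)) : Ideal (MvPolynomial (Fin s) k) where
  carrier := {f | ∀ P ∈ E, MvPolynomial.eval P f = 0}
  zero_mem' := by intro P _; simp
  add_mem' := by intro f g hf hg P hP; simp [hf P hP, hg P hP]
  smul_mem' := by intro c f hf P hP; simp [smul_eq_mul, hf P hP]

/-- The syndrome functional `Λ_e ∈ Hom_k(S,k)` of an error vector `e` supported on a finite
set `E ⊆ k^s` of points: `Λ_e(p) = Σ_{P∈E} e_P p(P)`. -/
noncomputable def syndromeFunctional (E : Finset (Fin s → k)) (e : (Fin s → k) → k) :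
    Module.Dual k (MvPolynomial (Fin s) k) :=
  ∑ P ∈ E, e P • (MvPolynomial.aeval P).toLinearMap

/-- A point outside a finite set `T ⊆ k^s` is separated from `T` by a polynomial. -/
theorem exists_eval_ne_zero_of_notMem (T : Finset (Fin s → k)) {P : Fin s → k} (hP : P ∉ T) :
    ∃ q : MvPolynomial (Fin s) k, eval P q ≠ 0 ∧ ∀ Q ∈ T, eval Q q = 0 := by
  classical
  have hsep (Q : Fin s → k) (hQ : Q ∈ T) : ∃ i, P i ≠ Q i :=
    Function.ne_iff.mp fun h => hP (h ▸ hQ)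
  choose i hi using hsep
  refine ⟨∏ Q ∈ T.attach, (X (i Q.1 Q.2) - C (Q.1 (i Q.1 Q.2))), ?_, fun Q hQ => ?_⟩
  · rw [map_prod, Finset.prod_ne_zero_iff]
    intro Q _
    simpa [sub_eq_zero] using hi Q.1 Q.2
  · rw [map_prod]
    exact Finset.prod_eq_zero (Finset.mem_attach T ⟨Q, hQ⟩) (by simp)

theorem syndromeFunctional_apply (E : Finset (Fin s → k)) (e : (Fin s → k) → k)
    (p : MvPolynomial (Fin s) k) :
    syndromeFunctional E e p = ∑ P ∈ E, e P * eval P p := by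
  simp [syndromeFunctional, LinearMap.sum_apply, aeval_eq_eval]

theorem mem_locatorIdeal_iff_syndromeFunctional_mul_eq_zero (E : Finset (Fin s → k))
    (e : (Fin s → k) → k) (he : ∀ P ∈ E, e P ≠ 0) (f : MvPolynomial (Fin s) k) :
    f ∈ locatorIdeal E ↔ ∀ p, syndromeFunctional E e (f * p) = 0 := by
  classical
  simp only [syndromeFunctional_apply, map_mul]
  refine ⟨fun hf p => Finset.sum_eq_zero fun P hP => ?_, fun h P hP => ?_⟩
  · rw [show eval P f = 0 from hf P hP, zero_mul, mul_zero]
  · obtain ⟨q, hqP, hq⟩ := exists_eval_ne_zero_of_notMem (E.erase P) (Finset.notMem_erase P E)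
    have hsum := h q
    rw [Finset.sum_eq_single_of_mem P hP fun Q hQ hQP => by
      rw [hq Q (Finset.mem_erase.mpr ⟨hQP, hQ⟩), mul_zero, mul_zero]] at hsum
    simpa [he P hP, hqP] using hsum

theorem mem_submodPerp_span_singleton (Λ : Module.Dual k (MvPolynomial (Fin s) k))
    (f : MvPolynomial (Fin s) k) :
    f ∈ submodPerp (Submodule.span (MvPolynomial (Fin s) k) {Λ}) ↔ ∀ p, Λ (f * p) = 0 := by
  change (∀ Λ' ∈ Submodule.span (MvPolynomial (Fin s) k) {Λ}, Λ' f = 0) ↔ _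
  simp only [Submodule.mem_span_singleton, forall_exists_index, forall_apply_eq_imp_iff,
    dual_smul_apply, mul_comm f]

/-- For a finite set of points `E ⊆ k^s` and a fixed error vector `e` with
`e_P ≠ 0` for all `P ∈ E`, the error-locator ideal satisfies `I(E) = ⟨Λ_e⟩^⊥`, where
`⟨Λ_e⟩` is the `S`-submodule of `Hom_k(S,k)` generated by `Λ_e`; i.e.,
`I(E) = {f ∈ S : Λ_e(f p) = 0 for all p ∈ S}`. -/
theorem locator_eq_perp_of_syndrome (k : Type*) [Field k] (s : ℕ) (hs : 1 ≤ s)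
    (E : Finset (Fin s → k)) (e : (Fin s → k) → k) (he : ∀ P ∈ E, e P ≠ 0) :
    locatorIdeal E =
      submodPerp (Submodule.span (MvPolynomial (Fin s) k) {syndromeFunctional E e}) ∧
    (∀ f : MvPolynomial (Fin s) k,
      f ∈ locatorIdeal E ↔
        ∀ p : MvPolynomial (Fin s) k, syndromeFunctional E e (f * p) = 0) := by
  have hmem := mem_locatorIdeal_iff_syndromeFunctional_mul_eq_zero E e he
  exact ⟨Ideal.ext fun f => (hmem f).trans (mem_submodPerp_span_singleton _ f).symm, hmem⟩
end

section
/- Let E ⊆ k^s be a finite set of points and e : E → k with e_P ≠ 0 for all P ∈ E. Define the syndromes E_u = Σ_{P∈E} e_P P^u for u ∈ ℕ^s. Then a polynomial f = Σ_m f_m X^m ∈ S vanishes at every point of E if and only if the linear recurrences Σ_m f_m E_{m+r} = 0 hold for every r ∈ ℕ^s. -/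
/-- The syndrome `E_u = Σ_{P∈E} e_P P^u` of the monomial `X^u` with respect to the error
vector `e` on the finite set of points `E ⊆ k^s`. -/
noncomputable def syndrome {k : Type*} [Field k] {s : ℕ} (E : Finset (Fin s → k))
    (e : (Fin s → k) → k) (u : Fin s →₀ ℕ) : k :=
  ∑ P ∈ E, e P * ∏ i, P i ^ u i

open MvPolynomial in
/-- The recurrence sum shifted by `r` is the sum of `e_P f(P) P^r` over the points `P ∈ E`. -/
theorem sum_coeff_mul_syndrome {k : Type*} [Field k] {s : ℕ} (E : Finset (Fin s → k))
    (e : (Fin s → k) → k) (f : MvPolynomial (Fin s) k) (r : Fin s →₀ ℕ) :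
    ∑ m ∈ f.support, f.coeff m * syndrome E e (m + r) =
      ∑ P ∈ E, e P * eval P f * ∏ i, P i ^ r i := by
  simp only [syndrome, eval_eq', Finset.mul_sum, Finset.sum_mul]
  rw [Finset.sum_comm]
  refine Finset.sum_congr rfl fun P _ => Finset.sum_congr rfl fun m _ => ?_
  simp only [Finsupp.add_apply, pow_add, Finset.prod_mul_distrib]
  ring

open MvPolynomial in
/-- Evaluations at distinct points are linearly independent, already when tested on monomials. -/
theorem eq_zero_of_sum_mul_prod_pow_eq_zero {k : Type*} [Field k] {s : ℕ}
    (E : Finset (Fin s → k)) (c : (Fin s → k) → k)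
    (h : ∀ r : Fin s →₀ ℕ, ∑ P ∈ E, c P * ∏ i, P i ^ r i = 0) :
    ∀ P ∈ E, c P = 0 := by
  have hinj : Function.Injective
      fun P : Fin s → k => ((eval P : MvPolynomial (Fin s) k →+* k) : MvPolynomial (Fin s) k →* k) := by
    intro P Q hPQ
    funext i
    simpa using DFunLike.congr_fun hPQ (X i)
  have hlin := (linearIndependent_monoidHom (MvPolynomial (Fin s) k) k).comp _ hinj
  have hzero : ∑ P ∈ E, c P • (aeval P : MvPolynomial (Fin s) k →ₐ[k] k).toLinearMap = 0 := by
    refine (basisMonomials (Fin s) k).ext fun r => ?_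
    simpa [LinearMap.sum_apply, aeval_monomial, Finsupp.prod_fintype] using h r
  refine linearIndependent_iff'.mp hlin E c ?_
  funext g
  simpa [LinearMap.sum_apply, Finset.sum_apply, aeval_eq_eval] using LinearMap.congr_fun hzero g

/-- Let `E ⊆ k^s` be finite and `e : E → k` with `e_P ≠ 0` for all `P ∈ E`.
A polynomial `f = Σ_m f_m X^m` vanishes at every point of `E` if and only if the linear
recurrences `Σ_m f_m E_{m+r} = 0` hold for every `r ∈ ℕ^s`. -/
theorem locator_iff_recurrences (k : Type*) [Field k] (s : ℕ) (hs : 1 ≤ s)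
    (E : Finset (Fin s → k)) (e : (Fin s → k) → k) (he : ∀ P ∈ E, e P ≠ 0)
    (f : MvPolynomial (Fin s) k) :
    (∀ P ∈ E, MvPolynomial.eval P f = 0) ↔
      ∀ r : Fin s →₀ ℕ,
        ∑ m ∈ f.support, f.coeff m * syndrome E e (m + r) = 0 := by
  simp only [sum_coeff_mul_syndrome]
  constructor
  · intro h r
    exact Finset.sum_eq_zero fun P hP => by simp [h P hP]
  · intro h P hP
    exact (mul_eq_zero.mp (eq_zero_of_sum_mul_prod_pow_eq_zero E
      (fun P => e P * MvPolynomial.eval P f) h P hP)).resolve_left (he P hP)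
end
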